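/- Let P = ⟨A | R⟩ be a finite presentation and let C := max{ℓ(r) : r ∈ R}. Then for every null-homotopic word w, Area(w) ≤ Height(w) ≤ (C+1)·Area(w) + ℓ(w), where Area(w) and Height(w) are respectively the minimum of Area(S) and of Height(S) over all null-P-sequences S for w. -/

import Mathlib

/-- A word over the alphabet `A`: a list of letters `(a, b)`, where the boolean `b`
records whether the letter is the generator `a` (when `true`) or its formal
inverse `a⁻¹` (when `false`). -/
abbrev Word (A : Type) := List (A × Bool)

/-- The formal inverse of a word. -/
def wordInv {A : Type} (w : Word A) : Word A := (w.map (fun p => (p.1, !p.2))).reverse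

/-- `IsCyclicConj v w` : the word `v` is a cyclic conjugate of the word `w`. -/
def IsCyclicConj {A : Type} (v w : Word A) : Prop := ∃ p q, w = p ++ q ∧ v = q ++ p

/-- A free reduction (deleting a subword `a a⁻¹`, `a` a generator or an inverse of a
generator) or a free expansion (inserting such a subword). -/
def FreeStep {A : Type} (w w' : Word A) : Prop :=
  (∃ (α β : Word A) (x : A × Bool), w = α ++ [x, (x.1, !x.2)] ++ β ∧ w' = α ++ β) ∨
  (∃ (α β : Word A) (x : A × Bool), w = α ++ β ∧ w' = α ++ [x, (x.1, !x.2)] ++ β)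

/-- An application of a relator from `R`: replace `w = αuβ` by `w' = αvβ` where
`u v⁻¹` is a cyclic conjugate of an element of `R` or of the inverse of an element
of `R`. -/
def RelStep {A : Type} (R : Set (Word A)) (w w' : Word A) : Prop :=
  ∃ (α u v β : Word A), w = α ++ u ++ β ∧ w' = α ++ v ++ β ∧
    ∃ r ∈ R, IsCyclicConj (u ++ wordInv v) r ∨ IsCyclicConj (u ++ wordInv v) (wordInv r)

/-- A `P`-sequence for the presentation with relator set `R` : a finite sequence of
words `seq 0, seq 1, …, seq len`, each obtained from the previous one by a free
reduction, a free expansion, or an application of a relator.  The field `isRel`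
records which steps are applications of relators. -/
structure PSeq {A : Type} (R : Set (Word A)) where
  len : ℕ
  seq : Fin (len + 1) → Word A
  isRel : Fin len → Bool
  step : ∀ i : Fin len,
    if isRel i then RelStep R (seq i.castSucc) (seq i.succ)
    else FreeStep (seq i.castSucc) (seq i.succ)

/-- The area of a `P`-sequence: the number of application-of-a-relator moves. -/
def PSeq.area {A : Type} {R : Set (Word A)} (S : PSeq R) : ℕ :=
  (Finset.univ.filter (fun i => S.isRel i = true)).card

/-- The filling length of a `P`-sequence: the maximum of the lengths of its words. -/
def PSeq.fl {A : Type} {R : Set (Word A)} (S : PSeq R) : ℕ :=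
  Finset.univ.sup (fun i => (S.seq i).length)

/-- The height of a `P`-sequence: its number of moves. -/
def PSeq.height {A : Type} {R : Set (Word A)} (S : PSeq R) : ℕ := S.len

/-- `S` is a null-`P`-sequence for the word `w`: it starts at `w` and ends at the
empty word. -/
def IsNullSeq {A : Type} {R : Set (Word A)} (S : PSeq R) (w : Word A) : Prop :=
  S.seq 0 = w ∧ S.seq (Fin.last S.len) = []

/-- The area of a null-homotopic word: the minimum of `Area(S)` over all
null-`P`-sequences `S` for `w`. -/
noncomputable def wordArea {A : Type} (R : Set (Word A)) (w : Word A) : ℕ :=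
  sInf {a | ∃ S : PSeq R, IsNullSeq S w ∧ S.area = a}

/-- The height of a null-homotopic word: the minimum of `Height(S)` over all
null-`P`-sequences `S` for `w`. -/
noncomputable def wordHeight {A : Type} (R : Set (Word A)) (w : Word A) : ℕ :=
  sInf {h | ∃ S : PSeq R, IsNullSeq S w ∧ S.height = h}

theorem wordInv_append {A : Type} (u v : Word A) :
    wordInv (u ++ v) = wordInv v ++ wordInv u := by
  simp [wordInv]

theorem wordInv_wordInv {A : Type} (u : Word A) : wordInv (wordInv u) = u := by
  simp [wordInv, Function.comp_def]

theorem length_wordInv {A : Type} (u : Word A) : (wordInv u).length = u.length := by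
  simp [wordInv]

theorem IsCyclicConj.wordInv {A : Type} {u v : Word A} (h : IsCyclicConj u v) :
    IsCyclicConj (wordInv u) (wordInv v) := by
  obtain ⟨p, q, rfl, rfl⟩ := h
  exact ⟨_, _, wordInv_append p q, wordInv_append q p⟩

theorem IsCyclicConj.length_eq {A : Type} {u v : Word A} (h : IsCyclicConj u v) :
    u.length = v.length := by
  obtain ⟨p, q, rfl, rfl⟩ := h
  simp [Nat.add_comm]

theorem IsCyclicConj.rotate {A : Type} {p q v : Word A} (h : IsCyclicConj (p ++ q) v) :
    IsCyclicConj (q ++ p) v := by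
  obtain ⟨a, b, rfl, hab⟩ := h
  rcases List.append_eq_append_iff.1 hab with ⟨c, rfl, rfl⟩ | ⟨c, rfl, rfl⟩
  · exact ⟨a ++ p, c, by simp, by simp⟩
  · exact ⟨c, q ++ b, by simp, by simp⟩

/-- The cyclic conjugates of the relators and of their inverses. -/
def IsRelator {A : Type} (R : Set (Word A)) (s : Word A) : Prop :=
  ∃ r ∈ R, IsCyclicConj s r ∨ IsCyclicConj s (wordInv r)

theorem IsRelator.wordInv {A : Type} {R : Set (Word A)} {s : Word A} (h : IsRelator R s) :
    IsRelator R (wordInv s) := by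
  obtain ⟨r, hr, h | h⟩ := h
  · exact ⟨r, hr, Or.inr h.wordInv⟩
  · exact ⟨r, hr, Or.inl (by simpa only [wordInv_wordInv] using h.wordInv)⟩

theorem IsRelator.rotate {A : Type} {R : Set (Word A)} {p q : Word A}
    (h : IsRelator R (p ++ q)) : IsRelator R (q ++ p) := by
  obtain ⟨r, hr, h⟩ := h
  exact ⟨r, hr, h.imp IsCyclicConj.rotate IsCyclicConj.rotate⟩

theorem IsRelator.length_le {A : Type} {R : Finset (Word A)} {s : Word A}
    (h : IsRelator (R : Set (Word A)) s) : s.length ≤ R.sup List.length := by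
  obtain ⟨r, hr, h⟩ := h
  have hs : s.length = r.length := by
    rcases h with h | h
    · exact h.length_eq
    · rw [h.length_eq, length_wordInv]
  rw [hs]
  exact Finset.le_sup (f := List.length) hr

/-- `Contracts R n w`: the word `w` can be transformed into the empty word by free reductions
and exactly `n` insertions of relators, without any free expansion. -/
inductive Contracts {A : Type} (R : Set (Word A)) : ℕ → Word A → Prop
  | nil : Contracts R 0 []
  | reduce {n : ℕ} (α β : Word A) (x : A × Bool) :
      Contracts R n (α ++ β) → Contracts R n (α ++ x :: (x.1, !x.2) :: β)
  | relator {n : ℕ} (α s β : Word A) :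
      IsRelator R s → Contracts R n (α ++ (s ++ β)) → Contracts R (n + 1) (α ++ β)

/-- `CyclicallyDeletable R m γ`: every cyclic conjugate of `γ` may be deleted from a contractible word at
the cost of `m` further relators. -/
def CyclicallyDeletable {A : Type} (R : Set (Word A)) (m : ℕ) (γ : Word A) : Prop :=
  ∀ p q, γ = p ++ q → ∀ n α β,
    Contracts R n (α ++ (q ++ (p ++ β))) → Contracts R (n + m) (α ++ β)

namespace CyclicallyDeletable

variable {A : Type} {R : Set (Word A)} {m : ℕ}

theorem nil : CyclicallyDeletable R 0 [] := by
  intro p q h n α β hc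
  obtain ⟨rfl, rfl⟩ := List.append_eq_nil_iff.1 h.symm
  simpa using hc

theorem contracts {γ : Word A} (h : CyclicallyDeletable R m γ) {n : ℕ} {α β : Word A}
    (hc : Contracts R n (α ++ (γ ++ β))) : Contracts R (n + m) (α ++ β) :=
  h [] γ rfl n α β (by simpa using hc)

theorem insert_relator {γ₁ γ₂ s : Word A} (hs : IsRelator R s) (h : CyclicallyDeletable R m (γ₁ ++ γ₂)) :
    CyclicallyDeletable R (m + 1) (γ₁ ++ (s ++ γ₂)) := by
  have del : ∀ {t : Word A}, IsRelator R t → ∀ {n : ℕ} {α β : Word A},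
      Contracts R n (α ++ (t ++ β)) → Contracts R (n + 1) (α ++ β) :=
    fun ht _ _ _ hc => Contracts.relator _ _ _ ht hc
  intro p q hpq n α β hc
  rw [Nat.add_comm m 1, ← Nat.add_assoc]
  rcases List.append_eq_append_iff.1 hpq with ⟨c, rfl, hq⟩ | ⟨c, rfl, rfl⟩
  · rcases List.append_eq_append_iff.1 hq with ⟨d, rfl, rfl⟩ | ⟨d, rfl, rfl⟩
    · refine h (γ₁ ++ d) q (by simp) _ _ _ ?_
      have := del hs (α := α ++ (q ++ γ₁)) (β := d ++ β) (n := n) (by simpa using hc)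
      simpa using this
    · rw [Nat.add_right_comm]
      refine del hs.rotate ?_
      have := h γ₁ γ₂ rfl n (α ++ d) (c ++ β) (by simpa using hc)
      simpa using this
  · refine h p (c ++ γ₂) (by simp) _ _ _ ?_
    have := del hs (α := α ++ c) (β := γ₂ ++ (p ++ β)) (n := n) (by simpa using hc)
    simpa using this

theorem reduce {γ₁ γ₂ : Word A} {x : A × Bool}
    (h : CyclicallyDeletable R m (γ₁ ++ x :: (x.1, !x.2) :: γ₂)) : CyclicallyDeletable R m (γ₁ ++ γ₂) := by
  intro p q hpq n α β hc
  rcases List.append_eq_append_iff.1 hpq with ⟨c, rfl, rfl⟩ | ⟨c, rfl, rfl⟩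
  · refine h (γ₁ ++ x :: (x.1, !x.2) :: c) q (by simp) _ _ _ ?_
    have := Contracts.reduce (R := R) (n := n) (α ++ (q ++ γ₁)) (c ++ β) x (by simpa using hc)
    simpa using this
  · refine h p (c ++ x :: (x.1, !x.2) :: γ₂) (by simp) _ _ _ ?_
    have := Contracts.reduce (R := R) (n := n) (α ++ c) (γ₂ ++ (p ++ β)) x (by simpa using hc)
    simpa using this

end CyclicallyDeletable

namespace Contracts

variable {A : Type} {R : Set (Word A)}

/-- Deletion of a subword `x γ x⁻¹`; the case of empty `γ` shows that free expansions never
help to contract a word. -/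
theorem delete_conj {n : ℕ} {w : Word A} (hc : Contracts R n w) :
    ∀ (α γ β : Word A) (x : A × Bool) (m : ℕ), w = α ++ x :: (γ ++ (x.1, !x.2) :: β) →
      CyclicallyDeletable R m γ → Contracts R (n + m) (α ++ β) := by
  induction hc with
  | nil => intro α γ β x m h; simp at h
  | @relator n a s b hs hc ih =>
    intro α γ β x m hw hγ
    rw [Nat.add_right_comm]
    rcases List.append_eq_append_iff.1 hw with ⟨c, rfl, rfl⟩ | ⟨c, rfl, h⟩
    · have := ih (a ++ (s ++ c)) γ β x m (by simp) hγ
      simpa using relator a s (c ++ β) hs (by simpa using this)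
    rcases List.cons_eq_append_iff.1 h with ⟨rfl, rfl⟩ | ⟨c, rfl, hsplit⟩
    · have := ih (α ++ s) γ β x m (by simp) hγ
      exact relator α s β hs (by simpa using this)
    have inside : ∀ d, γ = c ++ d → b = d ++ (x.1, !x.2) :: β →
        Contracts R (n + m + 1) (α ++ β) := by
      rintro d rfl rfl
      exact ih α (c ++ (s ++ d)) β x (m + 1) (by simp) (hγ.insert_relator hs)
    rcases List.append_eq_append_iff.1 hsplit with ⟨d, rfl, hrest⟩ | ⟨d, rfl, rfl⟩
    · rcases List.cons_eq_append_iff.1 hrest with ⟨rfl, rfl⟩ | ⟨d, rfl, rfl⟩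
      · exact inside [] (by simp) (by simp)
      · have := ih α γ (d ++ (s ++ b)) x m (by simp) hγ
        simpa using relator (α ++ d) s b hs (by simpa using this)
    · exact inside d rfl rfl
  | @reduce n a b y hc ih =>
    intro α γ β x m hw hγ
    obtain ⟨x, e⟩ := x
    obtain ⟨y, f⟩ := y
    have first : ∀ b', (y, f) = (x, e) → α = a → γ ++ (x, !e) :: β = b' → b' = (y, !f) :: b →
        Contracts R (n + m) (α ++ β) := by
      rintro _ hyx rfl rfl h
      obtain ⟨rfl, rfl⟩ := Prod.mk.inj hyx
      rcases List.append_eq_cons_iff.1 h with ⟨rfl, h⟩ | ⟨γ', rfl, rfl⟩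
      · obtain ⟨-, rfl⟩ := List.cons.inj h
        exact hγ.contracts hc
      · exact hγ [(y, !f)] γ' rfl _ _ _ (by simpa using hc)
    rcases List.append_eq_append_iff.1 hw with ⟨c, rfl, h⟩ | ⟨c, rfl, h⟩
    · rcases c with _ | ⟨z, _ | ⟨t, c⟩⟩
      · simp only [List.nil_append, List.cons.injEq] at h
        exact first _ h.1 (by simp) h.2.symm rfl
      · simp only [List.cons_append, List.nil_append, List.cons.injEq, Prod.mk.injEq] at h
        obtain ⟨rfl, ⟨rfl, rfl⟩, rfl⟩ := h
        have := hγ.contracts hc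
        simpa using this
      · simp only [List.cons_append, List.cons.injEq] at h
        obtain ⟨rfl, rfl, rfl⟩ := h
        have := ih (a ++ c) γ β (x, e) m (by simp) hγ
        simpa using reduce a (c ++ β) (y, f) (by simpa using this)
    rcases List.cons_eq_append_iff.1 h with ⟨rfl, hcons⟩ | ⟨c, rfl, hsplit⟩
    · simp only [List.cons.injEq] at hcons
      exact first _ hcons.1 (by simp) hcons.2.symm rfl
    have last : γ = c → (x, !e) :: β = (y, f) :: (y, !f) :: b →
        Contracts R (n + m) (α ++ β) := by
      rintro rfl h
      simp only [List.cons.injEq, Prod.mk.injEq] at h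
      obtain ⟨⟨rfl, rfl⟩, rfl⟩ := h
      have := hγ.contracts (n := n) (α := α ++ [(x, e)]) (β := b) (by simpa using hc)
      simpa using this
    rcases List.append_eq_append_iff.1 hsplit with ⟨d, rfl, hrest⟩ | ⟨d, rfl, hrest⟩
    · rcases List.cons_eq_append_iff.1 hrest with ⟨rfl, hb⟩ | ⟨d, rfl, rfl⟩
      · exact last (by simp) hb.symm
      · have := ih α γ (d ++ b) (x, e) m (by simp) hγ
        simpa using reduce (α ++ d) b (y, f) (by simpa using this)
    · rcases d with _ | ⟨z, _ | ⟨t, d⟩⟩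
      · exact last (by simp) hrest.symm
      · simp only [List.cons_append, List.nil_append, List.cons.injEq, Prod.mk.injEq,
          Bool.not_inj_iff] at hrest
        obtain ⟨rfl, ⟨rfl, rfl⟩, rfl⟩ := hrest
        exact hγ c [(y, f)] rfl _ _ _ (by simpa using hc)
      · simp only [List.cons_append, List.cons.injEq] at hrest
        obtain ⟨rfl, rfl, rfl⟩ := hrest
        exact ih α (c ++ d) β (x, e) m (by simp) hγ.reduce

theorem of_freeStep {n : ℕ} {w w' : Word A} (h : FreeStep w w') (hc : Contracts R n w') :
    Contracts R n w := by
  rcases h with ⟨α, β, x, rfl, rfl⟩ | ⟨α, β, x, rfl, rfl⟩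
  · simpa using hc.reduce α β x
  · exact hc.delete_conj α [] β x 0 (by simp) CyclicallyDeletable.nil

theorem insert_inv_append {n : ℕ} (u : Word A) {α β : Word A} (hc : Contracts R n (α ++ β)) :
    Contracts R n (α ++ (wordInv u ++ (u ++ β))) := by
  induction u generalizing α β with
  | nil => simpa [wordInv] using hc
  | cons x u ih =>
    have := reduce (α ++ wordInv u) (u ++ β) (x.1, !x.2) (by simpa using ih hc)
    simpa [wordInv] using this

theorem of_relStep {n : ℕ} {w w' : Word A} (h : RelStep R w w') (hc : Contracts R n w') :
    Contracts R (n + 1) w := by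
  obtain ⟨α, u, v, β, rfl, rfl, h⟩ := h
  have hs : IsRelator R (v ++ wordInv u) := by
    simpa only [wordInv_append, wordInv_wordInv] using IsRelator.wordInv (R := R) h
  have := insert_inv_append u hc
  simpa using relator α (v ++ wordInv u) (u ++ β) hs (by simpa using this)

theorem of_steps (k : ℕ) (seq : Fin (k + 1) → Word A) (isRel : Fin k → Bool)
    (step : ∀ i : Fin k, if isRel i then RelStep R (seq i.castSucc) (seq i.succ)
      else FreeStep (seq i.castSucc) (seq i.succ)) (hlast : seq (Fin.last k) = []) :
    Contracts R (Finset.univ.filter (fun i => isRel i = true)).card (seq 0) := by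
  induction k with
  | zero =>
    have : seq 0 = [] := hlast
    rw [this]
    exact nil
  | succ k ih =>
    have hc := ih (fun i => seq i.succ) (fun i => isRel i.succ) (fun i => step i.succ) hlast
    have h0 := step 0
    rw [Fin.card_filter_univ_succ]
    split_ifs at h0 ⊢ with hr
    · exact of_relStep h0 hc
    · exact of_freeStep h0 hc

theorem of_isNullSeq {S : PSeq R} {w : Word A} (h : IsNullSeq S w) : Contracts R S.area w := by
  rw [← h.1]
  exact of_steps S.len S.seq S.isRel S.step h.2

end Contracts

theorem exists_isNullSeq_cons {A : Type} {R : Set (Word A)} {w w' : Word A} {S : PSeq R}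
    (hS : IsNullSeq S w') (h : RelStep R w w' ∨ FreeStep w w') :
    ∃ T : PSeq R, IsNullSeq T w ∧ T.height = S.height + 1 := by
  classical
  refine ⟨⟨S.len + 1, Fin.cons w S.seq, Fin.cons (decide (RelStep R w w')) S.isRel, ?_⟩, ?_, rfl⟩
  · intro i
    refine Fin.cases ?_ (fun j => ?_) i
    · by_cases hr : RelStep R w w'
      · simp [hr, hS.1]
      · simpa [hr, hS.1] using h.resolve_left hr
    · simpa [← Fin.succ_castSucc] using S.step j
  · refine ⟨rfl, ?_⟩
    have := hS.2
    simpa [← Fin.succ_last] using this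

theorem Contracts.exists_isNullSeq {A : Type} {R : Finset (Word A)} {n : ℕ} {w : Word A}
    (hc : Contracts (R : Set (Word A)) n w) :
    ∃ S : PSeq (R : Set (Word A)), IsNullSeq S w ∧
      S.height ≤ (R.sup List.length + 1) * n + w.length := by
  induction hc with
  | nil => exact ⟨⟨0, fun _ => [], Fin.elim0, fun i => i.elim0⟩, ⟨rfl, rfl⟩, by simp [PSeq.height]⟩
  | @reduce n α β x _ ih =>
    obtain ⟨S, hS, hle⟩ := ih
    obtain ⟨T, hT, hTS⟩ := exists_isNullSeq_cons (w := α ++ x :: (x.1, !x.2) :: β) hS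
      (Or.inr (Or.inl ⟨α, β, x, by simp, rfl⟩))
    refine ⟨T, hT, ?_⟩
    simp only [List.length_append, List.length_cons] at hle ⊢
    omega
  | @relator n α s β hs _ ih =>
    obtain ⟨S, hS, hle⟩ := ih
    obtain ⟨T, hT, hTS⟩ := exists_isNullSeq_cons (w := α ++ β) hS
      (Or.inl ⟨α, [], s, β, by simp, by simp, hs.wordInv⟩)
    refine ⟨T, hT, ?_⟩
    have := hs.length_le
    simp only [List.length_append] at hle ⊢
    rw [Nat.mul_succ]
    omega

theorem wordArea_le_wordHeight {A : Type} (R : Set (Word A)) (w : Word A) :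
    wordArea R w ≤ wordHeight R w := by
  by_cases h : ∃ S : PSeq R, IsNullSeq S w
  · obtain ⟨S, hS⟩ := h
    obtain ⟨T, hT, hTh⟩ : wordHeight R w ∈ {h | ∃ S : PSeq R, IsNullSeq S w ∧ S.height = h} :=
      Nat.sInf_mem ⟨_, S, hS, rfl⟩
    rw [← hTh]
    refine (Nat.sInf_le ⟨T, hT, rfl⟩ : wordArea R w ≤ T.area).trans ?_
    exact (Finset.card_filter_le _ _).trans_eq (Finset.card_fin _)
  · have : {a | ∃ S : PSeq R, IsNullSeq S w ∧ S.area = a} = ∅ :=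
      Set.eq_empty_of_forall_notMem fun _ ⟨S, hS, _⟩ => h ⟨S, hS⟩
    simp [wordArea, this]

theorem wordHeight_le {A : Type} (R : Finset (Word A)) (w : Word A) :
    wordHeight (R : Set (Word A)) w ≤
      (R.sup List.length + 1) * wordArea (R : Set (Word A)) w + w.length := by
  by_cases h : ∃ S : PSeq (R : Set (Word A)), IsNullSeq S w
  · obtain ⟨S, hS⟩ := h
    obtain ⟨T, hT, hTa⟩ : wordArea (R : Set (Word A)) w ∈
        {a | ∃ S : PSeq (R : Set (Word A)), IsNullSeq S w ∧ S.area = a} :=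
      Nat.sInf_mem ⟨_, S, hS, rfl⟩
    obtain ⟨U, hU, hle⟩ := (Contracts.of_isNullSeq hT).exists_isNullSeq
    rw [← hTa]
    exact (Nat.sInf_le ⟨U, hU, rfl⟩ : wordHeight (R : Set (Word A)) w ≤ U.height).trans hle
  · have : {a | ∃ S : PSeq (R : Set (Word A)), IsNullSeq S w ∧ S.height = a} = ∅ :=
      Set.eq_empty_of_forall_notMem fun _ ⟨S, hS, _⟩ => h ⟨S, hS⟩
    simp [wordHeight, this]

/-- **Remark.**  For a finite presentation `⟨A ∣ R⟩` with `C := max{ℓ(r) : r ∈ R}`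
and every null-homotopic word `w`,
`Area(w) ≤ Height(w) ≤ (C+1)·Area(w) + ℓ(w)`. -/
theorem area_height_comparison
    {A : Type} [Fintype A] {G : Type} [Group G]
    (R : Finset (Word A)) (π : FreeGroup A →* G)
    (hsurj : Function.Surjective π)
    (hker : π.ker = Subgroup.normalClosure (FreeGroup.mk '' (R : Set (Word A))))
    (w : Word A) (hw : π (FreeGroup.mk w) = 1) :
    wordArea (R : Set (Word A)) w ≤ wordHeight (R : Set (Word A)) w ∧
    wordHeight (R : Set (Word A)) w ≤
      (R.sup List.length + 1) * wordArea (R : Set (Word A)) w + w.length := by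
  exact ⟨wordArea_le_wordHeight _ w, wordHeight_le R w⟩
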